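/- (Proposition 3, creation part: the map ρ preserves the ZF exchange relation among creation generators.) The elements α†_i(k) = Σ_j (a†_j(k)t_{ji}(k) + a†_j(−k)r_{ji}(−k)) satisfy, for all k₁,k₂ ∈ ℝ and indices i,j: α†_i(k₁)α†_j(k₂) = Σ_{p,q} α†_q(k₂)α†_p(k₁) [S₂₁(k₂,k₁)]^{(p,q)}_{(i,j)}. -/

import Mathlib

open scoped Matrix BigOperators

variable {n : ℕ}

/-- `[S₂₁(k₂,k₁)]^{(i,j)}_{(p,q)} = [S(k₂,k₁)]^{(j,i)}_{(q,p)}`. -/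
def S21 (S : ℝ → ℝ → Matrix (Fin n × Fin n) (Fin n × Fin n) ℂ) (k₂ k₁ : ℝ) :
    Matrix (Fin n × Fin n) (Fin n × Fin n) ℂ :=
  Matrix.of fun x y => S k₂ k₁ (x.2, x.1) (y.2, y.1)

/-- `M₁ = M ⊗ Iₙ`. -/
def leg1 {A : Type*} [Semiring A] [DecidableEq (Fin n)]
    (M : Matrix (Fin n) (Fin n) A) :
    Matrix (Fin n × Fin n) (Fin n × Fin n) A :=
  Matrix.of fun x y => if x.2 = y.2 then M x.1 y.1 else 0

/-- `M₂ = Iₙ ⊗ M`. -/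
def leg2 {A : Type*} [Semiring A] [DecidableEq (Fin n)]
    (M : Matrix (Fin n) (Fin n) A) :
    Matrix (Fin n × Fin n) (Fin n × Fin n) A :=
  Matrix.of fun x y => if x.1 = y.1 then M x.2 y.2 else 0

/-- entrywise embedding of a scalar `n² × n²` matrix into matrices over `𝒜`. -/
def emb (𝒜 : Type*) [Ring 𝒜] [Algebra ℂ 𝒜]
    (M : Matrix (Fin n × Fin n) (Fin n × Fin n) ℂ) :
    Matrix (Fin n × Fin n) (Fin n × Fin n) 𝒜 :=
  M.map (algebraMap ℂ 𝒜)

/-- entrywise embedding of a scalar `n × n` matrix into matrices over `𝒜`. -/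
def embn (𝒜 : Type*) [Ring 𝒜] [Algebra ℂ 𝒜] (M : Matrix (Fin n) (Fin n) ℂ) :
    Matrix (Fin n) (Fin n) 𝒜 :=
  M.map (algebraMap ℂ 𝒜)

/-- `W₁₂` acting on factors 1,2 of `(ℂⁿ)^{⊗3}`. -/
def leg12 (W : Matrix (Fin n × Fin n) (Fin n × Fin n) ℂ) :
    Matrix (Fin n × Fin n × Fin n) (Fin n × Fin n × Fin n) ℂ :=
  Matrix.of fun x y => if x.2.2 = y.2.2 then W (x.1, x.2.1) (y.1, y.2.1) else 0

/-- `W₁₃` acting on factors 1,3 of `(ℂⁿ)^{⊗3}`. -/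
def leg13 (W : Matrix (Fin n × Fin n) (Fin n × Fin n) ℂ) :
    Matrix (Fin n × Fin n × Fin n) (Fin n × Fin n × Fin n) ℂ :=
  Matrix.of fun x y => if x.2.1 = y.2.1 then W (x.1, x.2.2) (y.1, y.2.2) else 0

/-- `W₂₃` acting on factors 2,3 of `(ℂⁿ)^{⊗3}`. -/
def leg23 (W : Matrix (Fin n × Fin n) (Fin n × Fin n) ℂ) :
    Matrix (Fin n × Fin n × Fin n) (Fin n × Fin n × Fin n) ℂ :=
  Matrix.of fun x y => if x.1 = y.1 then W (x.2.1, x.2.2) (y.2.1, y.2.2) else 0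

/-- The matrix of `y` inserted as a row vector in the second factor. -/
def row2 {A : Type*} [Zero A] (y : Fin n → A) : Matrix (Fin n) (Fin n × Fin n) A :=
  Matrix.of fun i x => if i = x.1 then y x.2 else 0

/-- The matrix of `y` inserted as a row vector in the first factor. -/
def row1 {A : Type*} [Zero A] (y : Fin n → A) : Matrix (Fin n) (Fin n × Fin n) A :=
  Matrix.of fun i x => if i = x.2 then y x.1 else 0

section Rows

variable {A : Type*} [Semiring A]

theorem row2_vecMul (y : Fin n → A) (R : Matrix (Fin n) (Fin n) A) :
    row2 (y ᵥ* R) = row2 y * leg2 R := by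
  ext i ⟨p, q⟩
  simp [row2, leg2, Matrix.mul_apply, Matrix.vecMul, dotProduct, Fintype.sum_prod_type]

theorem row1_vecMul (x : Fin n → A) (T : Matrix (Fin n) (Fin n) A) :
    row1 (x ᵥ* T) = row1 x * leg1 T := by
  ext i ⟨p, q⟩
  simp [row1, leg1, Matrix.mul_apply, Matrix.vecMul, dotProduct, Fintype.sum_prod_type]

theorem vecMul_row2_apply (x y : Fin n → A) (i j : Fin n) :
    (x ᵥ* row2 y) (i, j) = x i * y j := by
  simp [row2, Matrix.vecMul, dotProduct]

theorem vecMul_row1_apply (x y : Fin n → A) (i j : Fin n) :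
    (y ᵥ* row1 x) (i, j) = y j * x i := by
  simp [row1, Matrix.vecMul, dotProduct]

end Rows

section Exchange

variable {𝒜 : Type*} [Ring 𝒜] [Algebra ℂ 𝒜]

theorem emb_one : emb 𝒜 (1 : Matrix (Fin n × Fin n) (Fin n × Fin n) ℂ) = 1 := by
  simp [emb]

theorem emb_mul (M N : Matrix (Fin n × Fin n) (Fin n × Fin n) ℂ) :
    emb 𝒜 (M * N) = emb 𝒜 M * emb 𝒜 N := by
  simp [emb, Matrix.map_mul]

theorem vecMul_row_exchange_iff (x y : Fin n → 𝒜)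
    (E : Matrix (Fin n × Fin n) (Fin n × Fin n) ℂ) :
    x ᵥ* row2 y = y ᵥ* row1 x ᵥ* emb 𝒜 E ↔
      ∀ i j, x i * y j = ∑ p, ∑ q, E (p, q) (i, j) • (y q * x p) := by
  have key : ∀ i j, (y ᵥ* row1 x ᵥ* emb 𝒜 E) (i, j) =
      ∑ p, ∑ q, E (p, q) (i, j) • (y q * x p) := by
    intro i j
    rw [Matrix.vecMul, dotProduct, Fintype.sum_prod_type]
    simp only [vecMul_row1_apply, emb, Matrix.map_apply, Algebra.smul_def, Algebra.commutes]
  rw [funext_iff, Prod.forall]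
  simp only [key, vecMul_row2_apply]

theorem mul_row2_eq {T : Matrix (Fin n) (Fin n) 𝒜} {y : Fin n → 𝒜}
    {B C : Matrix (Fin n × Fin n) (Fin n × Fin n) ℂ}
    (h : ∀ i l j, T i l * y j =
      ∑ p, ∑ q, ∑ r, ∑ s, (B (i, p) (q, r) * C (s, r) (l, j)) • (y p * T q s)) :
    T * row2 y = row2 y * emb 𝒜 B * leg1 T * emb 𝒜 C := by
  have h1 : ∀ i q r, (row2 y * emb 𝒜 B) i (q, r) = ∑ p, B (i, p) (q, r) • y p := by
    intro i q r
    simp [row2, emb, Matrix.mul_apply, Fintype.sum_prod_type, Algebra.smul_def,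
      Algebra.commutes]
  have h2 : ∀ s r l j, (leg1 T * emb 𝒜 C) (s, r) (l, j) =
      ∑ q, C (q, r) (l, j) • T s q := by
    intro s r l j
    simp [leg1, emb, Matrix.mul_apply, Fintype.sum_prod_type, Algebra.smul_def,
      Algebra.commutes]
  ext i ⟨l, j⟩
  have h3 : (T * row2 y) i (l, j) = T i l * y j := by
    simp [row2, Matrix.mul_apply]
  rw [h3, h, Matrix.mul_assoc _ (leg1 T), Matrix.mul_apply, Fintype.sum_prod_type]
  simp only [h1, h2, Finset.sum_mul_sum, smul_mul_smul_comm]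
  rw [Finset.sum_comm]
  refine Finset.sum_congr rfl fun q _ => ?_
  rw [Finset.sum_comm]

theorem mul_row1_eq {T : Matrix (Fin n) (Fin n) 𝒜} {y : Fin n → 𝒜}
    {B C : Matrix (Fin n × Fin n) (Fin n × Fin n) ℂ}
    (h : ∀ i l j, T i l * y j =
      ∑ p, ∑ q, ∑ r, ∑ s, (B (p, i) (r, q) * C (r, s) (j, l)) • (y p * T q s)) :
    T * row1 y = row1 y * emb 𝒜 B * leg2 T * emb 𝒜 C := by
  let e := Equiv.prodComm (Fin n) (Fin n)
  have := congrArg (Matrix.submatrix · id e)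
    (mul_row2_eq (B := B.submatrix e e) (C := C.submatrix e e) h)
  simp only [← Matrix.submatrix_mul_equiv _ _ id e e,
    ← Matrix.submatrix_mul_equiv _ _ id (Equiv.refl _) e] at this
  exact this

/-- The exchange relation for dressed row vectors `x T` and `y R`. -/
theorem dressed_exchange {x y : Fin n → 𝒜} {T R : Matrix (Fin n) (Fin n) 𝒜}
    {B B' C D E : Matrix (Fin n × Fin n) (Fin n × Fin n) ℂ}
    (hxy : ∀ i j, x i * y j = ∑ p, ∑ q, B' (p, q) (i, j) • (y q * x p))
    (hT : ∀ i l j, T i l * y j =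
      ∑ p, ∑ q, ∑ r, ∑ s, (B (i, p) (q, r) * C (s, r) (l, j)) • (y p * T q s))
    (hR : ∀ i l j, R i l * x j =
      ∑ p, ∑ q, ∑ r, ∑ s, (B' (p, i) (r, q) * D (r, s) (j, l)) • (x p * R q s))
    (hTR : emb 𝒜 B * leg1 T * emb 𝒜 C * leg2 R = leg2 R * emb 𝒜 D * leg1 T * emb 𝒜 E) (i j) :
    (x ᵥ* T) i * (y ᵥ* R) j =
      ∑ p, ∑ q, E (p, q) (i, j) • ((y ᵥ* R) q * (x ᵥ* T) p) := by
  revert i j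
  rw [← vecMul_row_exchange_iff] at hxy ⊢
  have hT := mul_row2_eq hT
  have hR := mul_row1_eq hR
  calc x ᵥ* T ᵥ* row2 (y ᵥ* R)
      = x ᵥ* (T * row2 y * leg2 R) := by
        rw [row2_vecMul, Matrix.vecMul_vecMul, Matrix.mul_assoc]
    _ = x ᵥ* row2 y ᵥ* (emb 𝒜 B * leg1 T * emb 𝒜 C * leg2 R) := by
        rw [hT, Matrix.vecMul_vecMul]; simp only [Matrix.mul_assoc]
    _ = y ᵥ* (row1 x * emb 𝒜 B' * leg2 R * emb 𝒜 D * leg1 T * emb 𝒜 E) := by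
        rw [hxy, hTR]; simp only [Matrix.vecMul_vecMul, Matrix.mul_assoc]
    _ = y ᵥ* R ᵥ* row1 (x ᵥ* T) ᵥ* emb 𝒜 E := by
        rw [← hR, row1_vecMul]; simp only [Matrix.vecMul_vecMul, Matrix.mul_assoc]

end Exchange

theorem stmt_10
    (hn : 1 ≤ n)
    (S : ℝ → ℝ → Matrix (Fin n × Fin n) (Fin n × Fin n) ℂ)
    (hU : ∀ k₁ k₂, S k₁ k₂ * S21 S k₂ k₁ = 1)
    (hYB : ∀ k₁ k₂ k₃,
      leg12 (S k₁ k₂) * leg13 (S k₁ k₃) * leg23 (S k₂ k₃) =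
        leg23 (S k₂ k₃) * leg13 (S k₁ k₃) * leg12 (S k₁ k₂))
    (𝒜 : Type*) [Ring 𝒜] [Algebra ℂ 𝒜]
    (a ad : ℝ → Fin n → 𝒜)
    (t r : ℝ → Matrix (Fin n) (Fin n) 𝒜)
    (hZF1 : ∀ k₁ k₂ (i j : Fin n), a k₁ i * a k₂ j =
      ∑ p, ∑ q, S21 S k₂ k₁ (i, j) (p, q) • (a k₂ q * a k₁ p))
    (hZF2 : ∀ k₁ k₂ (i j : Fin n), ad k₁ i * ad k₂ j =
      ∑ p, ∑ q, S21 S k₂ k₁ (p, q) (i, j) • (ad k₂ q * ad k₁ p))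
    (hE1 : ∀ k₁ k₂ (i j l : Fin n), a k₁ i * t k₂ j l =
      ∑ q, ∑ r', ∑ s, ∑ m,
        (S21 S k₂ k₁ (i, j) (r', q) * S k₁ k₂ (r', s) (m, l)) • (t k₂ q s * a k₁ m))
    (hE2 : ∀ k₁ k₂ (i j l : Fin n), a k₁ i * r k₂ j l =
      ∑ q, ∑ r', ∑ s, ∑ m,
        (S21 S k₂ k₁ (i, j) (r', q) * S k₁ (-k₂) (r', s) (m, l)) • (r k₂ q s * a k₁ m))
    (hE3 : ∀ k₁ k₂ (i l j : Fin n), t k₁ i l * ad k₂ j =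
      ∑ p, ∑ q, ∑ r', ∑ s,
        (S k₁ k₂ (i, p) (q, r') * S21 S k₂ k₁ (s, r') (l, j)) • (ad k₂ p * t k₁ q s))
    (hE4 : ∀ k₁ k₂ (i l j : Fin n), r k₁ i l * ad k₂ j =
      ∑ p, ∑ q, ∑ r', ∑ s,
        (S k₁ k₂ (i, p) (q, r') * S21 S k₂ (-k₁) (s, r') (l, j)) • (ad k₂ p * r k₁ q s))
    (hE5 : ∀ k₁ k₂,
      emb 𝒜 (S k₁ k₂) * leg1 (t k₁) * emb 𝒜 (S21 S k₂ k₁) * leg2 (t k₂) =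
        leg2 (t k₂) * emb 𝒜 (S k₁ k₂) * leg1 (t k₁) * emb 𝒜 (S21 S k₂ k₁))
    (hE6 : ∀ k₁ k₂,
      emb 𝒜 (S k₁ k₂) * leg1 (t k₁) * emb 𝒜 (S21 S k₂ k₁) * leg2 (r k₂) =
        leg2 (r k₂) * emb 𝒜 (S k₁ (-k₂)) * leg1 (t k₁) * emb 𝒜 (S21 S (-k₂) k₁))
    (hE7 : ∀ k₁ k₂,
      emb 𝒜 (S k₁ k₂) * leg1 (r k₁) * emb 𝒜 (S21 S k₂ (-k₁)) * leg2 (r k₂) =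
        leg2 (r k₂) * emb 𝒜 (S k₁ (-k₂)) * leg1 (r k₁) * emb 𝒜 (S21 S (-k₂) (-k₁)))
    (hE8 : ∀ k, t k * t k + r k * r (-k) = 1)
    (hE9 : ∀ k, t k * r k + r k * t (-k) = 0)
    (al ald A Ad : ℝ → Fin n → 𝒜)
    (hal : ∀ k (i : Fin n), al k i = ∑ j, (t k i j * a k j + r k i j * a (-k) j))
    (hald : ∀ k (i : Fin n), ald k i = ∑ j, (ad k j * t k j i + ad (-k) j * r (-k) j i))
    (hA : ∀ k (i : Fin n), A k i = (2 : ℂ)⁻¹ • (a k i + al k i))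
    (hAd : ∀ k (i : Fin n), Ad k i = (2 : ℂ)⁻¹ • (ad k i + ald k i))
    :
    ∀ k₁ k₂ (i j : Fin n),
      ald k₁ i * ald k₂ j = ∑ p, ∑ q, S21 S k₂ k₁ (p, q) (i, j) • (ald k₂ q * ald k₁ p) := by
  have hUe : ∀ k₁ k₂, emb 𝒜 (S k₁ k₂) * emb 𝒜 (S21 S k₂ k₁) = 1 := fun k₁ k₂ => by
    rw [← emb_mul, hU, emb_one]
  have hrt : ∀ k₁ k₂,
      emb 𝒜 (S k₁ k₂) * leg1 (r k₁) * emb 𝒜 (S21 S k₂ (-k₁)) * leg2 (t k₂) =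
        leg2 (t k₂) * emb 𝒜 (S k₁ k₂) * leg1 (r k₁) * emb 𝒜 (S21 S k₂ (-k₁)) := by
    intro k₁ k₂
    let e := Equiv.prodComm (Fin n) (Fin n)
    have h6 : emb 𝒜 (S21 S k₂ k₁) * leg2 (t k₂) * emb 𝒜 (S k₁ k₂) * leg1 (r k₁) =
        leg1 (r k₁) * emb 𝒜 (S21 S k₂ (-k₁)) * leg2 (t k₂) * emb 𝒜 (S (-k₁) k₂) := by
      have := congrArg (Matrix.submatrix · e e) (hE6 k₂ k₁)
      simp only [← Matrix.submatrix_mul_equiv _ _ e e e] at this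
      exact this
    calc emb 𝒜 (S k₁ k₂) * leg1 (r k₁) * emb 𝒜 (S21 S k₂ (-k₁)) * leg2 (t k₂)
        = emb 𝒜 (S k₁ k₂) * (leg1 (r k₁) * emb 𝒜 (S21 S k₂ (-k₁)) * leg2 (t k₂) *
            emb 𝒜 (S (-k₁) k₂)) * emb 𝒜 (S21 S k₂ (-k₁)) := by
          simp only [Matrix.mul_assoc, hUe, Matrix.mul_one]
      _ = (emb 𝒜 (S k₁ k₂) * emb 𝒜 (S21 S k₂ k₁)) * leg2 (t k₂) * emb 𝒜 (S k₁ k₂) *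
            leg1 (r k₁) * emb 𝒜 (S21 S k₂ (-k₁)) := by
          rw [← h6]; simp only [Matrix.mul_assoc]
      _ = _ := by rw [hUe, Matrix.one_mul]
  have hald' : ∀ k, ald k = ad k ᵥ* t k + ad (-k) ᵥ* r (-k) := by
    intro k
    ext i
    simp [hald, Matrix.vecMul, dotProduct, Finset.sum_add_distrib]
  have hR4 : ∀ k₁ k₂ (i l j : Fin n), r (-k₁) i l * ad k₂ j =
      ∑ p, ∑ q, ∑ r', ∑ s,
        (S (-k₁) k₂ (i, p) (q, r') * S21 S k₂ k₁ (s, r') (l, j)) •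
          (ad k₂ p * r (-k₁) q s) := by
    intro k₁ k₂
    simpa only [neg_neg] using hE4 (-k₁) k₂
  intro k₁ k₂ i j
  have tt := dressed_exchange (hZF2 k₁ k₂) (hE3 k₁ k₂) (D := S k₁ k₂) (hE3 k₂ k₁)
    (hE5 k₁ k₂) i j
  have tr := dressed_exchange (hZF2 k₁ (-k₂)) (hE3 k₁ (-k₂)) (D := S k₁ k₂)
    (E := S21 S k₂ k₁) (hR4 k₂ k₁)
    (by simpa only [neg_neg] using hE6 k₁ (-k₂)) i j
  have rt := dressed_exchange (hZF2 (-k₁) k₂) (hR4 k₁ k₂) (D := S (-k₁) k₂)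
    (E := S21 S k₂ k₁) (hE3 k₂ (-k₁))
    (by simpa only [neg_neg] using hrt (-k₁) k₂) i j
  have rr := dressed_exchange (hZF2 (-k₁) (-k₂)) (hR4 k₁ (-k₂)) (D := S (-k₁) k₂)
    (E := S21 S k₂ k₁) (hR4 k₂ (-k₁))
    (by simpa only [neg_neg] using hE7 (-k₁) (-k₂)) i j
  simp only [hald', Pi.add_apply, add_mul, mul_add, smul_add, Finset.sum_add_distrib, tt, tr,
    rt, rr]
  abel
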